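/- arXiv:2002.08413 — 2 statements merged into one kernel-verified Lean document; each statement's English description precedes it below -/
import Mathlib

section
/- Let φ, ψ : ℝ² → ℝ be differentiable functions with φ(p) ≥ 0 for all p ∈ ℝ². Define the Poisson bracket {f, g}(p) = ∂₁f(p)·∂₂g(p) − ∂₂f(p)·∂₁g(p), where ∂₁, ∂₂ denote partial derivatives in the first and second coordinates. If {φ², ψ}(p) = 0 for all p ∈ ℝ², then {φ, ψ}(p) = 0 for all p ∈ ℝ². -/
/-- The Poisson bracket `{f, g}(p) = ∂₁f(p)·∂₂g(p) − ∂₂f(p)·∂₁g(p)`. -/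
noncomputable def pbracket (f g : ℝ × ℝ → ℝ) (p : ℝ × ℝ) : ℝ :=
  fderiv ℝ f p (1, 0) * fderiv ℝ g p (0, 1) - fderiv ℝ f p (0, 1) * fderiv ℝ g p (1, 0)

theorem pbracket_sq_left {f : ℝ × ℝ → ℝ} {p : ℝ × ℝ} (hf : DifferentiableAt ℝ f p)
    (g : ℝ × ℝ → ℝ) : pbracket (fun q => f q ^ 2) g p = 2 * f p * pbracket f g p := by
  have hsq : fderiv ℝ (fun q => f q ^ 2) p = (2 * f p) • fderiv ℝ f p := by
    simpa using (hf.hasFDerivAt.pow 2).fderiv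
  simp only [pbracket, hsq, smul_apply, smul_eq_mul]
  ring

theorem stmt_7 (φ ψ : ℝ × ℝ → ℝ) (hφ : Differentiable ℝ φ) (hψ : Differentiable ℝ ψ)
    (hφ0 : ∀ p : ℝ × ℝ, 0 ≤ φ p)
    (h : ∀ p : ℝ × ℝ, pbracket (fun q => φ q ^ 2) ψ p = 0) :
    ∀ p : ℝ × ℝ, pbracket φ ψ p = 0 := by
  intro p
  rcases (hφ0 p).eq_or_lt with hp | hp
  · have hmin : IsLocalMin φ p := Filter.Eventually.of_forall fun q => hp ▸ hφ0 q
    simp [pbracket, hmin.fderiv_eq_zero]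
  · have hmul := h p
    rw [pbracket_sq_left (hφ p)] at hmul
    exact (mul_eq_zero.mp hmul).resolve_left (by positivity)
end

section
/- Let f : ℝ → ℂ be measurable and bounded (there is C with ‖f(x)‖ ≤ C for all x), and suppose the mean value M(f) exists: (1/T)·∫₀ᵀ f(x) dx → m as T → ∞. Let β : ℝ → ℂ be continuous with compact support and ∫ β = 1. Define the convolution (f ⋆ β)(x) = ∫ f(x − y)·β(y) dy. Then the mean value of f ⋆ β exists and equals m: (1/T)·∫₀ᵀ (f ⋆ β)(x) dx → m as T → ∞. -/
open Filter MeasureTheory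

lemma intervalIntegrable_of_measurable_of_norm_le {f : ℝ → ℂ} (hf : Measurable f) {C : ℝ}
    (hC : ∀ x, ‖f x‖ ≤ C) (a b : ℝ) : IntervalIntegrable f volume a b :=
  (intervalIntegrable_const (c := C)).mono_fun hf.aestronglyMeasurable
    (ae_of_all _ fun x => (hC x).trans (le_abs_self C))

lemma norm_average_le {g : ℝ → ℂ} {C : ℝ} (hC : ∀ x, ‖g x‖ ≤ C) {T : ℝ} (hT : 0 < T) :
    ‖(1 / T : ℂ) * ∫ x in (0:ℝ)..T, g x‖ ≤ C := by
  have h := intervalIntegral.norm_integral_le_of_norm_le_const (a := 0) (b := T) (f := g)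
    (C := C) fun x _ => hC x
  rw [sub_zero, abs_of_pos hT] at h
  rw [norm_mul, norm_div, norm_one, Complex.norm_real, Real.norm_of_nonneg hT.le,
    one_div_mul_eq_div, div_le_iff₀ hT]
  exact h

/-- The mean value of a bounded measurable function is translation invariant. -/
lemma tendsto_average_comp_sub {f : ℝ → ℂ} (hf : Measurable f) {C : ℝ} (hC : ∀ x, ‖f x‖ ≤ C)
    {m : ℂ}
    (hM : Tendsto (fun T : ℝ => (1 / T : ℂ) * ∫ x in (0:ℝ)..T, f x) atTop (nhds m)) (y : ℝ) :
    Tendsto (fun T : ℝ => (1 / T : ℂ) * ∫ x in (0:ℝ)..T, f (x - y)) atTop (nhds m) := by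
  have hi := intervalIntegrable_of_measurable_of_norm_le hf hC
  have hsplit (T : ℝ) : (∫ x in (0:ℝ)..T, f (x - y)) - ∫ x in (0:ℝ)..T, f x
      = (∫ x in (-y)..0, f x) - ∫ x in (T - y)..T, f x := by
    rw [intervalIntegral.integral_comp_sub_right, zero_sub,
      intervalIntegral.integral_interval_sub_interval_comm (hi _ _) (hi _ _) (hi _ _)]
  have hzero : Tendsto (fun T : ℝ => (1 / T : ℂ) *
      ((∫ x in (0:ℝ)..T, f (x - y)) - ∫ x in (0:ℝ)..T, f x)) atTop (nhds 0) := by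
    refine squeeze_zero_norm' (a := fun T : ℝ => 2 * C * |y| / T) ?_
      (tendsto_const_nhds.div_atTop tendsto_id)
    filter_upwards [eventually_gt_atTop 0] with T hT
    have h₁ := intervalIntegral.norm_integral_le_of_norm_le_const (a := -y) (b := 0)
      (C := C) fun x _ => hC x
    have h₂ := intervalIntegral.norm_integral_le_of_norm_le_const (a := T - y) (b := T)
      (C := C) fun x _ => hC x
    rw [sub_neg_eq_add, zero_add] at h₁
    rw [sub_sub_cancel] at h₂
    rw [hsplit, norm_mul, norm_div, norm_one, Complex.norm_real, Real.norm_of_nonneg hT.le,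
      one_div_mul_eq_div]
    gcongr
    linarith [norm_sub_le (∫ x in (-y)..0, f x) (∫ x in (T - y)..T, f x)]
  simpa [mul_sub] using hzero.add hM

/-- Convolving a bounded measurable function with an integrable kernel multiplies its mean value
by the integral of the kernel. -/
lemma tendsto_average_convolution {f : ℝ → ℂ} (hf : Measurable f) {C : ℝ}
    (hC : ∀ x, ‖f x‖ ≤ C) {m : ℂ}
    (hM : Tendsto (fun T : ℝ => (1 / T : ℂ) * ∫ x in (0:ℝ)..T, f x) atTop (nhds m))
    {β : ℝ → ℂ} (hβ : Integrable β) :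
    Tendsto (fun T : ℝ => (1 / T : ℂ) * ∫ x in (0:ℝ)..T, ∫ y, f (x - y) * β y)
      atTop (nhds (m * ∫ y, β y)) := by
  have hlim : Tendsto (fun T : ℝ => ∫ y, ((1 / T : ℂ) * ∫ x in (0:ℝ)..T, f (x - y)) * β y)
      atTop (nhds (∫ y, m * β y)) := by
    refine tendsto_integral_filter_of_dominated_convergence (fun y => C * ‖β y‖) ?_ ?_
      (hβ.norm.const_mul C) (ae_of_all _ fun y => (tendsto_average_comp_sub hf hC hM y).mul_const _)
    · filter_upwards [eventually_gt_atTop 0] with T hT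
      simp_rw [intervalIntegral.integral_of_le hT.le]
      have hm : StronglyMeasurable fun y : ℝ => ∫ x in Set.Ioc 0 T, f (x - y) :=
        StronglyMeasurable.integral_prod_right (f := fun y x : ℝ => f (x - y))
          (hf.comp (measurable_snd.sub measurable_fst)).stronglyMeasurable
      exact (hm.const_mul _).aestronglyMeasurable.mul hβ.aestronglyMeasurable
    · filter_upwards [eventually_gt_atTop 0] with T hT
      refine ae_of_all _ fun y => ?_
      rw [norm_mul]
      gcongr
      exact norm_average_le (fun x => hC (x - y)) hT
  rw [integral_const_mul] at hlim
  refine hlim.congr' ?_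
  filter_upwards [eventually_gt_atTop 0] with T hT
  have hint : Integrable (Function.uncurry fun x y : ℝ => f (x - y) * β y)
      ((volume.restrict (Set.Ioc 0 T)).prod volume) :=
    (hβ.comp_snd (volume.restrict (Set.Ioc 0 T))).bdd_mul
      (hf.comp (measurable_fst.sub measurable_snd)).aestronglyMeasurable
      (ae_of_all _ fun p => hC (p.1 - p.2))
  simp_rw [intervalIntegral.integral_of_le hT.le]
  rw [integral_integral_swap hint]
  simp_rw [mul_assoc, integral_const_mul, integral_mul_const]

theorem stmt_14 (f : ℝ → ℂ) (hf : Measurable f) (C : ℝ) (hC : ∀ x, ‖f x‖ ≤ C)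
    (m : ℂ)
    (hM : Tendsto (fun T : ℝ => (1 / T : ℂ) * ∫ x in (0:ℝ)..T, f x) atTop (nhds m))
    (β : ℝ → ℂ) (hβc : Continuous β) (hβs : HasCompactSupport β)
    (hβ1 : ∫ y, β y = 1) :
    Tendsto (fun T : ℝ => (1 / T : ℂ) * ∫ x in (0:ℝ)..T, ∫ y, f (x - y) * β y)
      atTop (nhds m) := by
  simpa [hβ1] using
    tendsto_average_convolution hf hC hM (hβc.integrable_of_hasCompactSupport hβs)
end
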